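/- (Correctness of the incremental concatenation algorithm.) Let D be a byte pair dictionary and let w, w' be nonempty strings with 𝕋^D(w) = u₁⌢…⌢uₙ and 𝕋^D(w') = u'₁⌢…⌢u'ₘ. Suppose that for some indices 1 ≤ i ≤ n and 1 ≤ j ≤ m the tokenization 𝕋^D(uᵢuᵢ₊₁⋯uₙ · u'₁⋯u'ⱼ) = v₁⌢…⌢vₖ satisfies k ≥ 2, v₁ = uᵢ, and vₖ = u'ⱼ. Then 𝕋^D(ww') = u₁⌢…⌢uᵢ₋₁⌢v₁⌢…⌢vₖ⌢u'ⱼ₊₁⌢…⌢u'ₘ. -/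

import Mathlib

/-!
Formalization of byte pair encoding (BPE) tokenization semantics.

* The alphabet is a type `α`.
* A *token* is a (intended nonempty) string over `α`, i.e. a `List α`.
* A *tokenization* is a finite sequence of tokens.
* A *byte pair dictionary* is a finite sequence of rules (pairs of tokens),
  listed in order of decreasing priority.
-/

/-- A token: a string over the alphabet `α`. -/
abbrev Token (α : Type*) := List α

/-- A tokenization: a finite sequence of tokens. -/
abbrev Tok (α : Type*) := List (Token α)

/-- A byte pair dictionary: a finite sequence of rules, in decreasing priority order. -/
abbrev Dict (α : Type*) := List (Token α × Token α)

variable {α : Type*}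

/-- `π`: concatenation of the tokens of a tokenization. -/
def pi (τ : Tok α) : List α := τ.flatten

/-- All tokens of a tokenization are nonempty strings. -/
def NETok (τ : Tok α) : Prop := ∀ u ∈ τ, u ≠ []

/-- All rules of a dictionary consist of nonempty tokens. -/
def NEDict (D : Dict α) : Prop := ∀ r ∈ D, r.1 ≠ [] ∧ r.2 ≠ []

/-- `Tk∅(w)`: the initial tokenization of `w` into single symbols. -/
def TkEmpty (w : List α) : Tok α := w.map (fun a => [a])

/-- Rule `r` applies in tokenization `τ` at position `p`
(i.e. `τ = φ ⌢ r.1 ⌢ r.2 ⌢ φ'` with `|φ| = p`). -/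
def AppliesAt (r : Token α × Token α) (τ : Tok α) (p : ℕ) : Prop :=
  ∃ φ φ' : Tok α, φ.length = p ∧ τ = φ ++ r.1 :: r.2 :: φ'

/-- Rule `r` applies somewhere in tokenization `τ`. -/
def Applies (r : Token α × Token α) (τ : Tok α) : Prop := ∃ p, AppliesAt r τ p

/-- The result of applying (merging by) rule `r` at position `p` in `τ`. -/
def applyAt (r : Token α × Token α) (τ : Tok α) (p : ℕ) : Tok α :=
  τ.take p ++ (r.1 ++ r.2) :: τ.drop (p + 2)

/-- The base (nondeterministic) rewriting step `τ ⇒ τ'`: some rule of `D`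
is applied somewhere in `τ`. -/
def BStep (D : Dict α) (τ τ' : Tok α) : Prop :=
  ∃ (φ φ' : Tok α) (u v : Token α),
    (u, v) ∈ D ∧ τ = φ ++ u :: v :: φ' ∧ τ' = φ ++ (u ++ v) :: φ'

/-- `τ` is a base tokenization of `w`: reachable from `Tk∅(w)` by base steps,
and no rule of `D` applies to it. -/
def IsBase (D : Dict α) (w : List α) (τ : Tok α) : Prop :=
  Relation.ReflTransGen (BStep D) (TkEmpty w) τ ∧ ∀ τ', ¬ BStep D τ τ'

/-- `BStepN D n τ τ'`: `τ'` is obtained from `τ` by exactly `n` base steps. -/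
def BStepN (D : Dict α) : ℕ → Tok α → Tok α → Prop
  | 0 => Eq
  | n + 1 => fun τ τ'' => ∃ τ', BStepN D n τ τ' ∧ BStep D τ' τ''

/-- One SentencePiece step applying the rule of index `i` (highest priority
applicable) at position `p` (leftmost occurrence of that rule). -/
def SPStepAt (D : Dict α) (i p : ℕ) (τ τ' : Tok α) : Prop :=
  ∃ h : i < D.length,
    AppliesAt (D[i]'h) τ p ∧
    (∀ (j : ℕ) (hj : j < D.length), j < i → ¬ Applies (D[j]'hj) τ) ∧
    (∀ q < p, ¬ AppliesAt (D[i]'h) τ q) ∧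
    τ' = applyAt (D[i]'h) τ p

/-- One SentencePiece step: the highest priority applicable rule is applied
at its leftmost occurrence. -/
def SPStep (D : Dict α) (τ τ' : Tok α) : Prop := ∃ i p, SPStepAt D i p τ τ'

/-- One SentencePiece step which applies the rule `r` of `D`. -/
def SPStepRule (D : Dict α) (r : Token α × Token α) (τ τ' : Tok α) : Prop :=
  ∃ (i p : ℕ) (h : i < D.length), D[i]'h = r ∧ SPStepAt D i p τ τ'

/-- `τ` is the SentencePiece tokenization `𝕋^D(w)` of `w`: reachable from
`Tk∅(w)` by SentencePiece steps, and no further step applies. -/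
def IsSP (D : Dict α) (w : List α) (τ : Tok α) : Prop :=
  Relation.ReflTransGen (SPStep D) (TkEmpty w) τ ∧ ∀ τ', ¬ SPStep D τ τ'

/-- One application of rule `r` at its leftmost occurrence. -/
def LeftStep (r : Token α × Token α) (τ τ' : Tok α) : Prop :=
  ∃ p, AppliesAt r τ p ∧ (∀ q < p, ¬ AppliesAt r τ q) ∧ τ' = applyAt r τ p

/-- Exhaustive application of rule `r`, leftmost first, until it no longer applies. -/
def Exhaust (r : Token α × Token α) (τ τ' : Tok α) : Prop :=
  Relation.ReflTransGen (LeftStep r) τ τ' ∧ ¬ Applies r τ'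

/-- One HuggingFace (macro) step using the rule of index `i`: the rule of
index `i` is the highest-priority applicable rule, and it is applied
repeatedly at its leftmost occurrence until it no longer applies. -/
def HFStepAt (D : Dict α) (i : ℕ) (τ τ' : Tok α) : Prop :=
  ∃ h : i < D.length,
    Applies (D[i]'h) τ ∧
    (∀ (j : ℕ) (hj : j < D.length), j < i → ¬ Applies (D[j]'hj) τ) ∧
    Exhaust (D[i]'h) τ τ'

/-- One HuggingFace (macro) step. -/
def HFStep (D : Dict α) (τ τ' : Tok α) : Prop := ∃ i, HFStepAt D i τ τ'

/-- One HuggingFace (macro) step which uses the rule `r` of `D`. -/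
def HFStepRule (D : Dict α) (r : Token α × Token α) (τ τ' : Tok α) : Prop :=
  ∃ (i : ℕ) (h : i < D.length), D[i]'h = r ∧ HFStepAt D i τ τ'

/-- `τ` is the HuggingFace tokenization `𝕋_hf^D(w)` of `w`. -/
def IsHF (D : Dict α) (w : List α) (τ : Tok α) : Prop :=
  Relation.ReflTransGen (HFStep D) (TkEmpty w) τ ∧ ∀ τ', ¬ HFStep D τ τ'

/-- A dictionary is *proper* if each side of each rule of length `> 1` is
produced by some higher-priority rule. -/
def Proper (D : Dict α) : Prop :=
  ∀ (j : ℕ) (hj : j < D.length),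
    (1 < (D[j]'hj).1.length →
      ∃ (i : ℕ) (hi : i < D.length), i < j ∧ (D[j]'hj).1 = (D[i]'hi).1 ++ (D[i]'hi).2) ∧
    (1 < (D[j]'hj).2.length →
      ∃ (i : ℕ) (hi : i < D.length), i < j ∧ (D[j]'hj).2 = (D[i]'hi).1 ++ (D[i]'hi).2)

/-- `max{|uv| : u⌢v ∈ D}`: the maximal total length of a rule of `D`. -/
def maxPairLen (D : Dict α) : ℕ := (D.map (fun r => (r.1 ++ r.2).length)).foldr max 0

/-- `l` is a sufficient lookahead bound for `D`: whenever `𝕋^D(π(φ)π(τ)) = φ⌢τ` with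
`|π(τ)| ≥ l`, appending any further text keeps `φ` as a prefix of the tokenization. -/
def GoodLookahead (D : Dict α) (l : ℕ) : Prop :=
  ∀ φ τ ψ : Tok α, l ≤ (pi τ).length →
    IsSP D (pi φ ++ pi τ) (φ ++ τ) →
    ∃ ψ', IsSP D (pi φ ++ pi τ ++ pi ψ) (φ ++ ψ')

/-- The lookahead constant `l(D)`: the smallest sufficient lookahead bound. -/
noncomputable def lookaheadConst (D : Dict α) : ℕ := sInf {l | GoodLookahead D l}

theorem appliesAt_iff {r : Token α × Token α} {τ : Tok α} {p : ℕ} :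
    AppliesAt r τ p ↔ τ[p]? = some r.1 ∧ τ[p + 1]? = some r.2 := by
  constructor
  · rintro ⟨φ, φ', rfl, rfl⟩
    simp
  · rintro ⟨h₁, h₂⟩
    obtain ⟨hp, h₁⟩ := List.getElem?_eq_some_iff.1 h₁
    obtain ⟨hp', h₂⟩ := List.getElem?_eq_some_iff.1 h₂
    refine ⟨τ.take p, τ.drop (p + 2), by simp; omega, ?_⟩
    rw [← h₁, ← h₂, List.getElem_cons_drop, List.getElem_cons_drop, List.take_append_drop]

theorem AppliesAt.add_two_le {r : Token α × Token α} {τ : Tok α} {p : ℕ}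
    (h : AppliesAt r τ p) : p + 2 ≤ τ.length := by
  obtain ⟨φ, φ', rfl, rfl⟩ := h
  simp only [List.length_append, List.length_cons]
  omega

theorem appliesAt_append_left_iff {r : Token α × Token α} {σ τ : Tok α} {p : ℕ}
    (hp : p + 2 ≤ σ.length) : AppliesAt r (σ ++ τ) p ↔ AppliesAt r σ p := by
  rw [appliesAt_iff, appliesAt_iff, List.getElem?_append_left (by omega),
    List.getElem?_append_left (by omega)]

theorem AppliesAt.append_left {r : Token α × Token α} {σ : Tok α} {p : ℕ}
    (h : AppliesAt r σ p) (τ : Tok α) : AppliesAt r (σ ++ τ) p :=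
  (appliesAt_append_left_iff h.add_two_le).2 h

theorem appliesAt_append_right_iff {r : Token α × Token α} {σ τ : Tok α} {p : ℕ} :
    AppliesAt r (σ ++ τ) (σ.length + p) ↔ AppliesAt r τ p := by
  rw [appliesAt_iff, appliesAt_iff, List.getElem?_append_right (by omega),
    List.getElem?_append_right (by omega), Nat.add_assoc, Nat.add_sub_cancel_left,
    Nat.add_sub_cancel_left]

theorem applyAt_append_left (r : Token α × Token α) {σ : Tok α} (τ : Tok α) {p : ℕ}
    (hp : p + 2 ≤ σ.length) : applyAt r (σ ++ τ) p = applyAt r σ p ++ τ := by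
  simp [applyAt, List.take_append_of_le_length (show p ≤ σ.length by omega),
    List.drop_append_of_le_length hp]

theorem applyAt_append_right (r : Token α × Token α) (σ τ : Tok α) (p : ℕ) :
    applyAt r (σ ++ τ) (σ.length + p) = σ ++ applyAt r τ p := by
  simp [applyAt, Nat.add_assoc, List.take_length_add_append, List.drop_length_add_append]

namespace SPStepAt

variable {D : Dict α} {i p : ℕ} {σ τ ρ : Tok α}

theorem add_two_le (h : SPStepAt D i p σ τ) : p + 2 ≤ σ.length := h.2.1.add_two_le

theorem exists_eq (h : SPStepAt D i p σ τ) : ∃ (φ φ' : Tok α) (u v : Token α),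
    φ.length = p ∧ σ = φ ++ u :: v :: φ' ∧ τ = φ ++ (u ++ v) :: φ' := by
  obtain ⟨hi, ⟨φ, φ', rfl, rfl⟩, -, -, rfl⟩ := h
  exact ⟨φ, φ', _, _, rfl, rfl, by simp [applyAt]⟩

theorem length_eq (h : SPStepAt D i p σ τ) : σ.length = τ.length + 1 := by
  obtain ⟨φ, φ', u, v, -, rfl, rfl⟩ := h.exists_eq
  simp only [List.length_append, List.length_cons]
  omega

theorem pi_eq (h : SPStepAt D i p σ τ) : pi τ = pi σ := by
  obtain ⟨φ, φ', u, v, -, rfl, rfl⟩ := h.exists_eq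
  simp [pi]

theorem unique {i' p' : ℕ} {τ' : Tok α} (h : SPStepAt D i p σ τ) (h' : SPStepAt D i' p' σ τ') :
    p = p' ∧ τ = τ' := by
  obtain ⟨hi, ha, hlt, hleft, rfl⟩ := h
  obtain ⟨hi', ha', hlt', hleft', rfl⟩ := h'
  obtain rfl : i = i' := by
    rcases lt_trichotomy i i' with hlt₁ | rfl | hlt₁
    · exact (hlt' _ hi hlt₁ ⟨_, ha⟩).elim
    · rfl
    · exact (hlt _ hi' hlt₁ ⟨_, ha'⟩).elim
  obtain rfl : p = p' := by
    rcases lt_trichotomy p p' with hlt₁ | rfl | hlt₁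
    · exact (hleft' _ hlt₁ ha).elim
    · rfl
    · exact (hleft _ hlt₁ ha').elim
  exact ⟨rfl, rfl⟩

/-- A step inside the left part of a concatenation is a step of the left part. -/
theorem restrict_left (h : SPStepAt D i p (σ ++ τ) ρ) (hp : p + 2 ≤ σ.length) :
    ∃ σ', SPStepAt D i p σ σ' ∧ ρ = σ' ++ τ := by
  obtain ⟨hi, ha, hlt, hleft, rfl⟩ := h
  exact ⟨_, ⟨hi, (appliesAt_append_left_iff hp).1 ha,
    fun j hj hji ⟨q, hq⟩ => hlt j hj hji ⟨q, hq.append_left τ⟩,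
    fun q hq hq' => hleft q hq (hq'.append_left τ), rfl⟩, applyAt_append_left _ τ hp⟩

/-- A step inside the right part of a concatenation is a step of the right part. -/
theorem restrict_right (h : SPStepAt D i (σ.length + p) (σ ++ τ) ρ) :
    ∃ τ', SPStepAt D i p τ τ' ∧ ρ = σ ++ τ' := by
  obtain ⟨hi, ha, hlt, hleft, rfl⟩ := h
  exact ⟨_, ⟨hi, appliesAt_append_right_iff.1 ha,
    fun j hj hji ⟨q, hq⟩ => hlt j hj hji ⟨_, appliesAt_append_right_iff.2 hq⟩,
    fun q hq hq' => hleft _ (Nat.add_lt_add_left hq _) (appliesAt_append_right_iff.2 hq'),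
    rfl⟩, applyAt_append_right _ σ τ p⟩

end SPStepAt

theorem pi_append (σ τ : Tok α) : pi (σ ++ τ) = pi σ ++ pi τ := List.flatten_append

theorem pi_TkEmpty (w : List α) : pi (TkEmpty w) = w := by
  induction w with
  | nil => rfl
  | cons a w ih => simpa [pi, TkEmpty] using ih

theorem pi_eq_of_reflTransGen_SPStep {D : Dict α} {σ τ : Tok α}
    (h : Relation.ReflTransGen (SPStep D) σ τ) : pi τ = pi σ := by
  induction h with
  | refl => rfl
  | tail _ hstep ih =>
    obtain ⟨i, p, hstep⟩ := hstep
    rw [hstep.pi_eq, ih]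

theorem IsSP.pi_eq {D : Dict α} {w : List α} {τ : Tok α} (h : IsSP D w τ) : pi τ = w := by
  rw [pi_eq_of_reflTransGen_SPStep h.1, pi_TkEmpty]

theorem exists_SPStep_of_appliesAt {D : Dict α} {τ : Tok α} {i p : ℕ} (hi : i < D.length)
    (h : AppliesAt (D[i]'hi) τ p) : ∃ τ', SPStep D τ τ' := by
  classical
  have hex : ∃ i, ∃ hi : i < D.length, Applies (D[i]'hi) τ := ⟨i, hi, p, h⟩
  obtain ⟨hi₀, hap⟩ := Nat.find_spec hex
  exact ⟨_, Nat.find hex, Nat.find hap, hi₀, Nat.find_spec hap,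
    fun j hj hlt hj' => Nat.find_min hex hlt ⟨hj, hj'⟩, fun q hq => Nat.find_min hap hq, rfl⟩

theorem exists_SPStep_append_left {D : Dict α} {σ σ' : Tok α} (h : SPStep D σ σ') (τ : Tok α) :
    ∃ ρ, SPStep D (σ ++ τ) ρ := by
  obtain ⟨i, p, hi, ha, -⟩ := h
  exact exists_SPStep_of_appliesAt hi (ha.append_left τ)

theorem exists_SPStep_append_right {D : Dict α} {τ τ' : Tok α} (σ : Tok α) (h : SPStep D τ τ') :
    ∃ ρ, SPStep D (σ ++ τ) ρ := by
  obtain ⟨i, p, hi, ha, -⟩ := h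
  exact exists_SPStep_of_appliesAt hi (appliesAt_append_right_iff.2 ha)

/-- `SplitSteps D σ τ φ ψ`: a SentencePiece derivation from `σ ++ τ` to `φ ++ ψ` in which
no step merges across the boundary, leading from `σ` to `φ` and from `τ` to `ψ`. -/
inductive SplitSteps (D : Dict α) : Tok α → Tok α → Tok α → Tok α → Prop
  | refl (φ ψ : Tok α) : SplitSteps D φ ψ φ ψ
  | left {σ σ' τ φ ψ : Tok α} {i p : ℕ} (h : SPStepAt D i p (σ ++ τ) (σ' ++ τ))
      (hl : SPStepAt D i p σ σ') (hs : SplitSteps D σ' τ φ ψ) : SplitSteps D σ τ φ ψ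
  | right {σ τ τ' φ ψ : Tok α} {i p : ℕ} (h : SPStepAt D i (σ.length + p) (σ ++ τ) (σ ++ τ'))
      (hr : SPStepAt D i p τ τ') (hs : SplitSteps D σ τ' φ ψ) : SplitSteps D σ τ φ ψ

namespace SplitSteps

variable {D : Dict α} {σ τ ρ φ χ ψ : Tok α}

theorem reflTransGen_left (h : SplitSteps D σ τ φ ψ) :
    Relation.ReflTransGen (SPStep D) σ φ := by
  induction h with
  | refl => exact .refl
  | left _ hl _ ih => exact .head ⟨_, _, hl⟩ ih
  | right _ _ _ ih => exact ih

theorem reflTransGen_right (h : SplitSteps D σ τ φ ψ) :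
    Relation.ReflTransGen (SPStep D) τ ψ := by
  induction h with
  | refl => exact .refl
  | left _ _ _ ih => exact ih
  | right _ hr _ ih => exact .head ⟨_, _, hr⟩ ih

theorem right_ne_nil (h : SplitSteps D σ τ φ ψ) (hψ : ψ ≠ []) : τ ≠ [] := by
  induction h with
  | refl => exact hψ
  | left _ _ _ ih => exact ih hψ
  | right _ hr _ _ =>
    rintro rfl
    simpa using hr.add_two_le

theorem of_not_step (h : SplitSteps D σ τ φ ψ) (hn : ∀ ρ, ¬ SPStep D (σ ++ τ) ρ) :
    σ = φ ∧ τ = ψ := by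
  cases h with
  | refl => exact ⟨rfl, rfl⟩
  | left h => exact (hn _ ⟨_, _, h⟩).elim
  | right h => exact (hn _ ⟨_, _, h⟩).elim

/-- Before a derivation ends, its next step lies on one side of the boundary. -/
theorem next {i p : ℕ} (h : SplitSteps D σ τ φ ψ) (hn : ∀ ρ, ¬ SPStep D (φ ++ ψ) ρ)
    (hstep : SPStepAt D i p (σ ++ τ) ρ) :
    (p + 2 ≤ σ.length ∧ ∃ σ', ρ = σ' ++ τ ∧ SplitSteps D σ' τ φ ψ) ∨
      (σ.length ≤ p ∧ ∃ τ', ρ = σ ++ τ' ∧ SplitSteps D σ τ' φ ψ) := by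
  cases h with
  | refl => exact (hn _ ⟨_, _, hstep⟩).elim
  | left h hl hs =>
    obtain ⟨rfl, rfl⟩ := hstep.unique h
    exact .inl ⟨hl.add_two_le, _, rfl, hs⟩
  | right h hr hs =>
    obtain ⟨rfl, rfl⟩ := hstep.unique h
    exact .inr ⟨by omega, _, rfl, hs⟩

/-- Two finished derivations that agree on a nonempty overlap glue together. -/
theorem glue (h₁ : SplitSteps D σ τ φ χ) (h₂ : SplitSteps D τ ρ χ ψ)
    (hn₁ : ∀ ξ, ¬ SPStep D (φ ++ χ) ξ) (hn₂ : ∀ ξ, ¬ SPStep D (χ ++ ψ) ξ) (hχ : χ ≠ []) :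
    Relation.ReflTransGen (SPStep D) (σ ++ τ ++ ρ) (φ ++ χ ++ ψ) ∧
      ∀ ξ, ¬ SPStep D (φ ++ χ ++ ψ) ξ := by
  induction hlen : (σ ++ τ ++ ρ).length generalizing σ τ ρ with
  | zero =>
    have := h₁.right_ne_nil hχ
    simp_all
  | succ n ih =>
    by_cases hs : ∃ ξ, SPStep D (σ ++ τ ++ ρ) ξ
    · obtain ⟨ξ, i, p, hstep⟩ := hs
      suffices ∃ σ' τ' ρ', ξ = σ' ++ τ' ++ ρ' ∧ SplitSteps D σ' τ' φ χ ∧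
          SplitSteps D τ' ρ' χ ψ by
        obtain ⟨σ', τ', ρ', rfl, h₁', h₂'⟩ := this
        have hl := hstep.length_eq
        obtain ⟨hr, hf⟩ := ih h₁' h₂' (by omega)
        exact ⟨.head ⟨i, p, hstep⟩ hr, hf⟩
      by_cases hp : p + 2 ≤ (σ ++ τ).length
      · obtain ⟨ζ, hζ, rfl⟩ := hstep.restrict_left hp
        rcases h₁.next hn₁ hζ with ⟨-, σ', rfl, h₁'⟩ | ⟨hσ, τ', rfl, h₁'⟩
        · exact ⟨σ', τ, ρ, rfl, h₁', h₂⟩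
        · obtain ⟨q, rfl⟩ := Nat.exists_eq_add_of_le hσ
          rw [List.append_assoc] at hstep
          obtain ⟨η, hη, hζη⟩ := hstep.restrict_right
          rw [List.append_assoc, List.append_cancel_left_eq] at hζη
          subst hζη
          rw [List.length_append] at hp
          rcases h₂.next hn₂ hη with ⟨-, τ'', he, h₂'⟩ | ⟨hτ, -⟩
          · rw [List.append_cancel_right_eq] at he
            subst he
            exact ⟨σ, τ', ρ, rfl, h₁', h₂'⟩
          · omega
      · have hτ := List.length_pos_of_ne_nil (h₁.right_ne_nil hχ)
        rw [List.length_append] at hp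
        obtain ⟨q, rfl⟩ := Nat.exists_eq_add_of_le (show σ.length ≤ p by omega)
        rw [List.append_assoc] at hstep
        obtain ⟨η, hη, rfl⟩ := hstep.restrict_right
        rcases h₂.next hn₂ hη with ⟨hq, -⟩ | ⟨-, ρ', rfl, h₂'⟩
        · omega
        · exact ⟨σ, τ, ρ', (List.append_assoc ..).symm, h₁, h₂'⟩
    · push Not at hs
      have hn : ∀ ξ, ¬ SPStep D (σ ++ τ) ξ := fun ξ h =>
        let ⟨ζ, hζ⟩ := exists_SPStep_append_left h ρ
        hs ζ hζ
      have hn' : ∀ ξ, ¬ SPStep D (τ ++ ρ) ξ := fun ξ h => by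
        obtain ⟨ζ, hζ⟩ := exists_SPStep_append_right σ h
        rw [← List.append_assoc] at hζ
        exact hs ζ hζ
      obtain ⟨rfl, rfl⟩ := h₁.of_not_step hn
      obtain ⟨-, rfl⟩ := h₂.of_not_step hn'
      exact ⟨.refl, hs⟩

end SplitSteps

theorem exists_splitSteps {D : Dict α} {σ φ ψ : Tok α}
    (h : Relation.ReflTransGen (SPStep D) σ (φ ++ ψ)) :
    ∃ σ₁ σ₂, σ = σ₁ ++ σ₂ ∧ SplitSteps D σ₁ σ₂ φ ψ := by
  induction h using Relation.ReflTransGen.head_induction_on with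
  | refl => exact ⟨φ, ψ, rfl, .refl φ ψ⟩
  | head hstep _ ih =>
    obtain ⟨i, p, hstep⟩ := hstep
    obtain ⟨σ₁, σ₂, rfl, hs⟩ := ih
    obtain ⟨X, Y, u, v, rfl, rfl, he⟩ := hstep.exists_eq
    rw [List.append_eq_append_iff] at he
    have right_of : ∀ l, X = σ₁ ++ l → σ₂ = l ++ (u ++ v) :: Y →
        ∃ τ₁ τ₂, X ++ u :: v :: Y = τ₁ ++ τ₂ ∧ SplitSteps D τ₁ τ₂ φ ψ := by
      rintro l rfl rfl
      rw [List.append_assoc, List.length_append] at hstep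
      obtain ⟨η, hη, he⟩ := hstep.restrict_right
      rw [List.append_cancel_left_eq] at he
      subst he
      exact ⟨σ₁, l ++ u :: v :: Y, List.append_assoc .., .right hstep hη hs⟩
    rcases he with ⟨l, hX, hσ₂⟩ | ⟨l, hσ₁, hY⟩
    · exact right_of l hX hσ₂
    · rcases List.cons_eq_append_iff.1 hY with ⟨rfl, h⟩ | ⟨l', rfl, rfl⟩
      · exact right_of [] (by simpa using hσ₁.symm) (by simpa using h)
      · subst hσ₁
        rw [show X ++ u :: v :: (l' ++ σ₂) = (X ++ u :: v :: l') ++ σ₂ by simp] at hstep ⊢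
        obtain ⟨η, hη, he⟩ := hstep.restrict_left (by simp)
        rw [List.append_cancel_right_eq] at he
        subst he
        exact ⟨_, σ₂, rfl, .left hstep hη hs⟩

namespace IsSP

variable {D : Dict α} {φ χ ψ : Tok α} {w : List α}

theorem splitSteps (h : IsSP D w (φ ++ ψ)) :
    SplitSteps D (TkEmpty (pi φ)) (TkEmpty (pi ψ)) φ ψ := by
  obtain ⟨σ₁, σ₂, he, hs⟩ := exists_splitSteps h.1
  obtain ⟨w₁, w₂, -, rfl, rfl⟩ := List.map_eq_append_iff.1 he
  have h₁ := pi_eq_of_reflTransGen_SPStep hs.reflTransGen_left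
  have h₂ := pi_eq_of_reflTransGen_SPStep hs.reflTransGen_right
  rw [show pi (List.map _ w₁) = w₁ from pi_TkEmpty w₁] at h₁
  rw [show pi (List.map _ w₂) = w₂ from pi_TkEmpty w₂] at h₂
  rw [h₁, h₂]
  exact hs

theorem of_append_left (h : IsSP D w (φ ++ ψ)) : IsSP D (pi φ) φ :=
  ⟨h.splitSteps.reflTransGen_left, fun _ hs =>
    let ⟨ρ, hρ⟩ := exists_SPStep_append_left hs ψ
    h.2 ρ hρ⟩

theorem of_append_right (h : IsSP D w (φ ++ ψ)) : IsSP D (pi ψ) ψ :=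
  ⟨h.splitSteps.reflTransGen_right, fun _ hs =>
    let ⟨ρ, hρ⟩ := exists_SPStep_append_right φ hs
    h.2 ρ hρ⟩

/-- Tokenizations that agree on a nonempty overlap glue together. -/
theorem glue {w' : List α} (h : IsSP D w (φ ++ χ)) (h' : IsSP D w' (χ ++ ψ)) (hχ : χ ≠ []) :
    IsSP D (pi (φ ++ χ ++ ψ)) (φ ++ χ ++ ψ) := by
  have := h.splitSteps.glue h'.splitSteps h.2 h'.2 hχ
  simpa only [IsSP, pi_append, TkEmpty, List.map_append] using this

end IsSP

/-- Correctness of the incremental concatenation algorithm.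
Indices are 0-based: `us[i]` is the token `uᵢ₊₁` of the paper (1-based). -/
theorem incremental_concat_correct (D : Dict α) (hD : NEDict D)
    (w w' : List α) (hw : w ≠ []) (hw' : w' ≠ [])
    (us us' vs : Tok α) (h : IsSP D w us) (h' : IsSP D w' us')
    (i j : ℕ) (hi : i < us.length) (hj : j < us'.length)
    (hv : IsSP D (pi (us.drop i) ++ pi (us'.take (j + 1))) vs)
    (hk : 2 ≤ vs.length)
    (hhead : vs.head? = some (us[i]'hi))
    (hlast : vs.getLast? = some (us'[j]'hj)) :
    IsSP D (w ++ w') (us.take i ++ vs ++ us'.drop (j + 1)) := by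
  have hus : us = us.take i ++ [us[i]] ++ us.drop (i + 1) := by simp
  have hus' : us' = us'.take j ++ ([us'[j]] ++ us'.drop (j + 1)) := by simp
  obtain ⟨V, rfl⟩ : ∃ V, vs = [us[i]] ++ V ++ [us'[j]] := by
    match vs, hk with
    | a :: b :: l, _ =>
      obtain rfl : a = us[i] := by simpa using hhead
      rw [List.getLast?_cons_cons] at hlast
      obtain ⟨V, hV⟩ := List.getLast?_eq_some_iff.1 hlast
      exact ⟨V, by simp [hV]⟩
  have h₁ : IsSP D _ (us.take i ++ [us[i]]) := (hus ▸ h : IsSP D w _).of_append_left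
  have h₂ : IsSP D _ ([us'[j]] ++ us'.drop (j + 1)) :=
    (hus' ▸ h' : IsSP D w' _).of_append_right
  have h₃ := h₁.glue (List.append_assoc .. ▸ hv) (by simp)
  rw [← List.append_assoc] at h₃
  have h₄ := h₃.glue h₂ (by simp)
  have hww' : w ++ w' = pi (us.take i ++ ([us[i]] ++ V ++ [us'[j]]) ++ us'.drop (j + 1)) := by
    rw [pi_append, pi_append, hv.pi_eq, ← h.pi_eq, ← h'.pi_eq, List.append_assoc,
      List.append_assoc (pi (us.drop i)), ← List.append_assoc, ← pi_append (us.take i),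
      ← pi_append (us'.take (j + 1)), List.take_append_drop, List.take_append_drop]
  rw [hww']
  simpa only [List.append_assoc] using h₄
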